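/- arXiv:2202.00817 — 2 statements merged into one kernel-verified Lean document; each statement's English description precedes it below -/
import Mathlib

section
/- Let (δ_{x₁}, p, φ, c_{1:H}, π_{1:H}) be a benign Lipschitz planning problem with a deterministic initial state x₁ ∈ ℝ^n, and let F(θ) = E_{w_{1:H} iid∼p}[V₁(x₁, w_{1:H}, θ)]. Then for each θ ∈ ℝ^d: (a) there exists a Lebesgue-measurable set Z ⊂ (ℝ^m)^H with P_{w_{1:H}∼p^H}[w_{1:H} ∈ Z] = 1 such that for every w_{1:H} ∈ Z the map θ' ↦ V₁(x₁, w_{1:H}, θ') is differentiable at θ; and (b) ∇F(θ) = E_{w_{1:H}∼p^H}[∇_θ V₁(x₁, w_{1:H}, θ)], where the expectation is taken in the almost-sure sense (the integrand defined arbitrarily as 0 off Z). In particular, the first-order batched gradient estimator is an unbiased estimator of ∇F(θ). -/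
open MeasureTheory

/-- A function into a normed space has polynomial growth if
`‖f z‖ ≤ a (1 + ‖z‖^b)` for all `z`, for some constants `a, b > 0`. -/
def PolyGrowth {E F : Type*} [NormedAddCommGroup E] [NormedAddCommGroup F] (f : E → F) : Prop :=
  ∃ a b : ℝ, 0 < a ∧ 0 < b ∧ ∀ z, ‖f z‖ ≤ a * (1 + ‖z‖ ^ b)

/-- A map is polynomially Lipschitz if on every ball of radius `R ≥ 1` it is Lipschitz
with constant `a R^b`. -/
def PolyLipschitz {E F : Type*} [NormedAddCommGroup E] [NormedAddCommGroup F]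
    (f : E → F) : Prop :=
  ∃ a b : ℝ, 0 < a ∧ 0 < b ∧ ∀ R : ℝ, 1 ≤ R → ∀ z z' : E, ‖z‖ ≤ R → ‖z'‖ ≤ R →
    ‖f z - f z'‖ ≤ a * R ^ b * ‖z - z'‖

/-- The state of the trajectory generated from `x₁` by
`x_{h+1} = φ(x_h, π_h(x_h, θ) + w_h)` (0-indexed: `traj ... 0 = x₁`). -/
def traj {X U Θ : Type*} [Add U] (φ : X → U → X) (π : ℕ → X → Θ → U)
    (x₁ : X) (w : ℕ → U) (θ : Θ) : ℕ → X
  | 0 => x₁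
  | h + 1 => φ (traj φ π x₁ w θ h) (π h (traj φ π x₁ w θ h) θ + w h)

/-- The cost-to-go `V_{h+1}(x_{h+1}, w_{h+1:H}, θ)` along the trajectory
(0-indexed; `cost2go ... 0` is the total cost `V₁(x₁, w_{1:H}, θ)`). -/
def cost2go {X U Θ : Type*} [Add U] (φ : X → U → X) (π : ℕ → X → Θ → U)
    (c : ℕ → X → U → ℝ) (H : ℕ) (x₁ : X) (w : ℕ → U) (θ : Θ) (h : ℕ) : ℝ :=
  ∑ h' ∈ Finset.Ico h H, c h' (traj φ π x₁ w θ h')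
    (π h' (traj φ π x₁ w θ h') θ + w h')

/-- Extension of a finite noise sequence `w : Fin H → U` to `ℕ → U` (by `0` beyond `H`). -/
def extNoise {U : Type*} [Zero U] {H : ℕ} (w : Fin H → U) : ℕ → U :=
  fun h => if hh : h < H then w ⟨h, hh⟩ else 0

/-! ### Polynomially Lipschitz maps, with natural number constants -/

/-- Polynomially Lipschitz with a single natural constant. -/
def PL {E F : Type*} [NormedAddCommGroup E] [NormedAddCommGroup F] (f : E → F) : Prop :=
  ∃ K : ℕ, ∀ R : ℝ, 1 ≤ R → ∀ z z' : E, ‖z‖ ≤ R → ‖z'‖ ≤ R →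
    ‖f z - f z'‖ ≤ K * R ^ K * ‖z - z'‖

section PLsec

variable {E F G : Type*} [NormedAddCommGroup E] [NormedAddCommGroup F] [NormedAddCommGroup G]

theorem PL.of {f : E → F} (C : ℝ) (k : ℕ)
    (h : ∀ R : ℝ, 1 ≤ R → ∀ z z' : E, ‖z‖ ≤ R → ‖z'‖ ≤ R →
      ‖f z - f z'‖ ≤ C * R ^ k * ‖z - z'‖) : PL f := by
  refine ⟨⌈C⌉₊ + k, fun R hR z z' hz hz' => (h R hR z z' hz hz').trans ?_⟩
  have h1 : C ≤ ((⌈C⌉₊ + k : ℕ) : ℝ) := by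
    push_cast
    have := Nat.le_ceil C
    have : (0 : ℝ) ≤ k := by positivity
    linarith
  have h2 : R ^ k ≤ R ^ (⌈C⌉₊ + k) := pow_le_pow_right₀ hR (by omega)
  have h0 : 0 ≤ R ^ k := by positivity
  gcongr

theorem PolyLipschitz.toPL {f : E → F} (h : PolyLipschitz f) : PL f := by
  obtain ⟨a, b, ha, hb, h⟩ := h
  refine PL.of a ⌈b⌉₊ fun R hR z z' hz hz' => (h R hR z z' hz hz').trans ?_
  have : R ^ b ≤ R ^ ⌈b⌉₊ := by
    rw [← Real.rpow_natCast]
    exact Real.rpow_le_rpow_of_exponent_le hR (Nat.le_ceil b)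
  gcongr

theorem PL.weaken {f : E → F} {K : ℕ} (h : ∀ R : ℝ, 1 ≤ R → ∀ z z' : E, ‖z‖ ≤ R → ‖z'‖ ≤ R →
    ‖f z - f z'‖ ≤ K * R ^ K * ‖z - z'‖) {L : ℕ} (hKL : K ≤ L) (R : ℝ) (hR : 1 ≤ R) (z z' : E)
    (hz : ‖z‖ ≤ R) (hz' : ‖z'‖ ≤ R) : ‖f z - f z'‖ ≤ L * R ^ L * ‖z - z'‖ := by
  refine (h R hR z z' hz hz').trans ?_
  have h2 : R ^ K ≤ R ^ L := pow_le_pow_right₀ hR hKL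
  have h1 : (K : ℝ) ≤ L := by exact_mod_cast hKL
  gcongr

theorem PL.growth {f : E → F} (h : PL f) : ∃ M k : ℕ, 1 ≤ M ∧ ∀ R : ℝ, 1 ≤ R → ∀ z : E,
    ‖z‖ ≤ R → ‖f z‖ ≤ M * R ^ k := by
  obtain ⟨K, h⟩ := h
  refine ⟨⌈‖f 0‖⌉₊ + K + 1, K + 1, by omega, fun R hR z hz => ?_⟩
  have h1 := h R hR z 0 hz (by simp; linarith)
  have h2 : ‖f z‖ ≤ ‖f z - f 0‖ + ‖f 0‖ := by
    simpa using norm_add_le (f z - f 0) (f 0)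
  have h3 := Nat.le_ceil ‖f 0‖
  have h4 : 1 ≤ R ^ (K + 1) := one_le_pow₀ hR
  rw [sub_zero] at h1
  have h5 : (K : ℝ) * R ^ K * ‖z‖ ≤ K * R ^ (K + 1) := by
    rw [pow_succ, ← mul_assoc]
    gcongr
  push_cast
  have h6 : ‖f 0‖ ≤ (⌈‖f 0‖⌉₊ : ℝ) * R ^ (K + 1) := by
    refine h3.trans ?_
    exact le_mul_of_one_le_right (by positivity) h4
  nlinarith

theorem PL.comp {g : F → G} {f : E → F} (hg : PL g) (hf : PL f) : PL (fun z => g (f z)) := by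
  obtain ⟨M, k, hM, hgr⟩ := hf.growth
  obtain ⟨K, hf⟩ := hf
  obtain ⟨L, hg⟩ := hg
  refine PL.of (L * M ^ L * K) (k * L + K) fun R hR z z' hz hz' => ?_
  have hM' : (1 : ℝ) ≤ M := by exact_mod_cast hM
  have h1 : (1 : ℝ) ≤ M * R ^ k := one_le_mul_of_one_le_of_one_le hM' (one_le_pow₀ hR)
  refine (hg _ h1 _ _ (hgr R hR z hz) (hgr R hR z' hz')).trans ?_
  have h2 := hf R hR z z' hz hz'
  calc (L : ℝ) * (M * R ^ k) ^ L * ‖f z - f z'‖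
      ≤ (L : ℝ) * (M * R ^ k) ^ L * (K * R ^ K * ‖z - z'‖) := by gcongr
    _ = _ := by ring

theorem PL.prodMk {f : E → F} {g : E → G} (hf : PL f) (hg : PL g) :
    PL (fun z => (f z, g z)) := by
  obtain ⟨K, hf⟩ := hf
  obtain ⟨L, hg⟩ := hg
  refine ⟨max K L, fun R hR z z' hz hz' => ?_⟩
  rw [Prod.mk_sub_mk, Prod.norm_mk]
  exact max_le (PL.weaken hf (le_max_left _ _) R hR z z' hz hz')
    (PL.weaken hg (le_max_right _ _) R hR z z' hz hz')

theorem PL.pi {ι : Type*} [Fintype ι] {f : ι → E → F} (hf : ∀ i, PL (f i)) :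
    PL (fun z i => f i z) := by
  choose K hf using hf
  refine ⟨Finset.univ.sup K, fun R hR z z' hz hz' => ?_⟩
  rw [pi_norm_le_iff_of_nonneg (by positivity)]
  intro i
  exact PL.weaken (hf i) (Finset.le_sup (Finset.mem_univ i)) R hR z z' hz hz'

theorem PL.const (c : F) : PL (fun _ : E => c) :=
  ⟨0, fun R hR z z' hz hz' => by simp⟩

theorem PL.clm [NormedSpace ℝ E] [NormedSpace ℝ F] (L : E →L[ℝ] F) : PL (fun z => L z) :=
  PL.of ‖L‖ 0 fun R hR z z' hz hz' => by
    rw [← map_sub, pow_zero, mul_one]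
    exact L.le_opNorm _

theorem PL.add {f g : E → F} (hf : PL f) (hg : PL g) : PL (fun z => f z + g z) := by
  obtain ⟨K, hf⟩ := hf
  obtain ⟨L, hg⟩ := hg
  refine PL.of (2 * (max K L : ℕ)) (max K L) fun R hR z z' hz hz' => ?_
  have h1 := PL.weaken hf (le_max_left K L) R hR z z' hz hz'
  have h2 := PL.weaken hg (le_max_right K L) R hR z z' hz hz'
  have h3 := norm_add_le (f z - f z') (g z - g z')
  rw [add_sub_add_comm]
  linarith

theorem PL.neg {f : E → F} (hf : PL f) : PL (fun z => - f z) := by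
  obtain ⟨K, hf⟩ := hf
  refine ⟨K, fun R hR z z' hz hz' => ?_⟩
  have h1 := hf R hR z z' hz hz'
  rwa [neg_sub_neg, norm_sub_rev]

theorem PL.sum {ι : Type*} (s : Finset ι) {f : ι → E → F} (hf : ∀ i, PL (f i)) :
    PL (fun z => ∑ i ∈ s, f i z) := by
  classical
  induction s using Finset.induction_on with
  | empty => simpa using PL.const (E := E) (0 : F)
  | insert i s hi ih => simpa [Finset.sum_insert hi] using (hf i).add ih

theorem PL.of_fderiv [NormedSpace ℝ E] [NormedSpace ℝ F] {f : E → F}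
    (hd : Differentiable ℝ f) (hg : PolyGrowth (fun q => fderiv ℝ f q)) : PL f := by
  obtain ⟨a, b, ha, hb, hg⟩ := hg
  refine PL.of (2 * a) ⌈b⌉₊ fun R hR z z' hz hz' => ?_
  refine Convex.norm_image_sub_le_of_norm_fderiv_le (s := Metric.closedBall (0 : E) R) (𝕜 := ℝ)
    (fun x _ => hd x) (fun x hx => ?_) (convex_closedBall _ _) (by simpa using hz')
    (by simpa using hz)
  have hx' : ‖x‖ ≤ R := by simpa using hx
  refine (hg x).trans ?_
  have h1 : ‖x‖ ^ b ≤ R ^ ⌈b⌉₊ := by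
    refine (Real.rpow_le_rpow (norm_nonneg _) hx' hb.le).trans ?_
    rw [← Real.rpow_natCast]
    exact Real.rpow_le_rpow_of_exponent_le hR (Nat.le_ceil b)
  have h2 : 1 ≤ R ^ ⌈b⌉₊ := one_le_pow₀ hR
  nlinarith

theorem PL.lipOn {f : E → F} (hf : PL f) (k : ℕ) :
    ∃ C : NNReal, LipschitzOnWith C f (Metric.ball 0 (k + 1)) := by
  obtain ⟨K, hf⟩ := hf
  refine ⟨⟨K * (k + 1 : ℝ) ^ K, by positivity⟩, LipschitzOnWith.of_dist_le_mul ?_⟩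
  intro x hx y hy
  rw [dist_eq_norm, dist_eq_norm]
  refine hf (k + 1) (by simp) x y ?_ ?_
  · exact (by simpa using hx : ‖x‖ < k + 1).le
  · exact (by simpa using hy : ‖y‖ < k + 1).le

theorem exists_mem_ball_nat (x : E) : ∃ k : ℕ, x ∈ Metric.ball (0 : E) (k + 1) := by
  obtain ⟨k, hk⟩ := exists_nat_ge ‖x‖
  exact ⟨k, by simp; linarith⟩

theorem PL.continuous {f : E → F} (hf : PL f) : Continuous f := by
  rw [continuous_iff_continuousAt]
  intro x
  obtain ⟨k, hk⟩ := exists_mem_ball_nat x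
  obtain ⟨C, hC⟩ := hf.lipOn k
  exact hC.continuousOn.continuousAt (Metric.isOpen_ball.mem_nhds hk)

/-- Rademacher for polynomially Lipschitz maps. -/
theorem PL.ae_differentiableAt [NormedSpace ℝ E] [NormedSpace ℝ F] [FiniteDimensional ℝ E]
    [FiniteDimensional ℝ F] [MeasurableSpace E] [BorelSpace E] (μ : Measure E)
    [μ.IsAddHaarMeasure] {f : E → F} (hf : PL f) : ∀ᵐ x ∂μ, DifferentiableAt ℝ f x := by
  have h : ∀ k : ℕ, ∀ᵐ x ∂μ, x ∈ Metric.ball (0 : E) (k + 1) →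
      DifferentiableWithinAt ℝ f (Metric.ball (0 : E) (k + 1)) x := fun k => by
    obtain ⟨C, hC⟩ := hf.lipOn k
    exact hC.ae_differentiableWithinAt_of_mem
  rw [← ae_all_iff] at h
  filter_upwards [h] with x hx
  obtain ⟨k, hk⟩ := exists_mem_ball_nat x
  exact (hx k hk).differentiableAt (Metric.isOpen_ball.mem_nhds hk)

/-- Polynomially Lipschitz self maps send null sets to null sets. -/
theorem PL.image_null [NormedSpace ℝ E] [FiniteDimensional ℝ E]
    [MeasurableSpace E] [BorelSpace E] (μ : Measure E)
    [μ.IsAddHaarMeasure] {f : E → E} (hf : PL f) {s : Set E} (hs : μ s = 0) :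
    μ (f '' s) = 0 := by
  have ac1 : μ ≪ Measure.hausdorffMeasure (Module.finrank ℝ E : ℝ) :=
    Measure.absolutelyContinuous_isAddHaarMeasure _ _
  have ac2 : Measure.hausdorffMeasure (Module.finrank ℝ E : ℝ) ≪ μ :=
    Measure.absolutelyContinuous_isAddHaarMeasure _ _
  apply ac1
  have hs' := ac2 hs
  have : f '' s ⊆ ⋃ k : ℕ, f '' (s ∩ Metric.ball (0 : E) (k + 1)) := by
    rintro _ ⟨x, hx, rfl⟩
    obtain ⟨k, hk⟩ := exists_mem_ball_nat x
    exact Set.mem_iUnion.2 ⟨k, x, ⟨hx, hk⟩, rfl⟩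
  refine measure_mono_null this (measure_iUnion_null fun k => ?_)
  obtain ⟨C, hC⟩ := hf.lipOn k
  have h1 := (hC.mono (Set.inter_subset_right (s := s))).hausdorffMeasure_image_le
    (d := (Module.finrank ℝ E : ℝ)) (by positivity)
  rw [measure_mono_null Set.inter_subset_left hs', mul_zero] at h1
  exact le_antisymm h1 bot_le

end PLsec

/-! ### Absolute continuity of products, moments -/

theorem pi_ac {U : Type*} [MeasurableSpace U] (μ ν : Measure U) [SigmaFinite μ] [SigmaFinite ν]
    (h : μ ≪ ν) (H : ℕ) :
    (Measure.pi fun _ : Fin H => μ) ≪ (Measure.pi fun _ : Fin H => ν) := by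
  induction H with
  | zero =>
    rw [Measure.pi_of_empty, Measure.pi_of_empty]
  | succ H ih =>
    have e1 := (measurePreserving_piFinSuccAbove (fun _ : Fin (H + 1) => μ) 0).symm
    have e2 := (measurePreserving_piFinSuccAbove (fun _ : Fin (H + 1) => ν) 0).symm
    rw [← e1.map_eq, ← e2.map_eq]
    exact (h.prod ih).map (MeasurableEquiv.measurable _)

theorem moments {m : ℕ} (p : Measure (EuclideanSpace ℝ (Fin m))) [IsProbabilityMeasure p]
    (ψ : EuclideanSpace ℝ (Fin m) → ℝ) (αc a b : ℝ) (ha : 0 < a)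
    (hp : p = volume.withDensity fun w => ENNReal.ofReal (Real.exp (αc - ψ w)))
    (hψlb : ∀ w, a * ‖w‖ - b ≤ ψ w)
    (hψ1 : Differentiable ℝ ψ) (k : ℕ) :
    Integrable (fun w => (1 + ‖w‖) ^ k) p := by
  have hm : Measurable fun w => ENNReal.ofReal (Real.exp (αc - ψ w)) := by
    have := hψ1.continuous.measurable
    fun_prop
  rw [hp, integrable_withDensity_iff_integrable_smul' hm (by simp)]
  have hfin : ((Module.finrank ℝ (EuclideanSpace ℝ (Fin m)) : ℕ) : ℝ) < ((m + 1 : ℕ) : ℝ) := by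
    simp
  have hint := integrable_one_add_norm (μ := (volume : Measure (EuclideanSpace ℝ (Fin m)))) hfin
  set N := k + (m + 1) with hN
  refine (hint.const_mul (Real.exp (αc + b + a) * (N.factorial / a ^ N))).mono' ?_ ?_
  · have := hψ1.continuous
    have hc : Continuous fun w => (ENNReal.ofReal (Real.exp (αc - ψ w))).toReal • (1 + ‖w‖) ^ k := by
      simp only [ENNReal.toReal_ofReal (Real.exp_pos _).le]
      fun_prop
    exact hc.aestronglyMeasurable
  · refine Filter.Eventually.of_forall fun w => ?_
    rw [ENNReal.toReal_ofReal (Real.exp_pos _).le, smul_eq_mul, Real.norm_of_nonneg (by positivity)]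
    have hr : 0 < 1 + ‖w‖ := by positivity
    have h1 := Real.pow_div_factorial_le_exp (x := a * (1 + ‖w‖)) (by positivity) N
    have h2 : (1 + ‖w‖) ^ N ≤ N.factorial / a ^ N * Real.exp (a * (1 + ‖w‖)) := by
      rw [mul_pow, div_le_iff₀ (by positivity)] at h1
      rw [div_mul_eq_mul_div, le_div_iff₀ (by positivity)]
      linarith
    rw [Real.rpow_neg hr.le, Real.rpow_natCast, ← div_eq_mul_inv, le_div_iff₀ (by positivity),
      mul_assoc, ← pow_add]
    have h3 : Real.exp (αc - ψ w) ≤ Real.exp (αc + b + a) * Real.exp (-(a * (1 + ‖w‖))) := by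
      rw [← Real.exp_add]
      apply Real.exp_le_exp.2
      have := hψlb w
      linarith
    calc Real.exp (αc - ψ w) * (1 + ‖w‖) ^ N
        ≤ (Real.exp (αc + b + a) * Real.exp (-(a * (1 + ‖w‖)))) *
          (N.factorial / a ^ N * Real.exp (a * (1 + ‖w‖))) := by gcongr
      _ = Real.exp (αc + b + a) * (N.factorial / a ^ N) *
          (Real.exp (-(a * (1 + ‖w‖))) * Real.exp (a * (1 + ‖w‖))) := by ring
      _ = _ := by rw [← Real.exp_add]; simp

/-- Moments of the product measure, sup norm. -/
theorem moments_pi {m H : ℕ} (p : Measure (EuclideanSpace ℝ (Fin m))) [IsProbabilityMeasure p]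
    (hmom : ∀ k : ℕ, Integrable (fun w => (1 + ‖w‖) ^ k) p) (k : ℕ) :
    Integrable (fun w : Fin H → EuclideanSpace ℝ (Fin m) => (1 + ‖w‖) ^ k)
      (Measure.pi fun _ : Fin H => p) := by
  have h1 : Integrable (fun w : Fin H → EuclideanSpace ℝ (Fin m) =>
      1 + ∑ i, (1 + ‖w i‖) ^ k) (Measure.pi fun _ : Fin H => p) := by
    refine (integrable_const _).add (integrable_finsetSum _ fun i _ => ?_)
    exact (measurePreserving_eval (fun _ : Fin H => p) i).integrable_comp_of_integrable (hmom k)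
  refine h1.mono' (by fun_prop) (Filter.Eventually.of_forall fun w => ?_)
  rw [Real.norm_of_nonneg (by positivity)]
  have hs : ∀ i, (1 + ‖w i‖) ^ k ≤ ∑ i, (1 + ‖w i‖) ^ k := fun i =>
    Finset.single_le_sum (f := fun i => (1 + ‖w i‖) ^ k) (fun _ _ => by positivity)
      (Finset.mem_univ i)
  rcases isEmpty_or_nonempty (Fin H) with hH | hH
  · have : w = 0 := Subsingleton.elim _ _
    simp [this]
  · obtain ⟨i, hi⟩ := Finite.exists_max (fun i => ‖w i‖)
    have hw : ‖w‖ ≤ ‖w i‖ := (pi_norm_le_iff_of_nonneg (norm_nonneg _)).2 hi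
    have h2 : (1 + ‖w‖) ^ k ≤ (1 + ‖w i‖) ^ k := by gcongr
    have := hs i
    linarith

/-! ### Open-loop trajectories -/

/-- Trajectory driven by a given sequence of controls. -/
def ctraj {X U : Type*} (φ : X → U → X) (x₁ : X) (u : ℕ → U) : ℕ → X
  | 0 => x₁
  | h + 1 => φ (ctraj φ x₁ u h) (u h)

theorem ctraj_congr {X U : Type*} (φ : X → U → X) (x₁ : X) (u v : ℕ → U) (h : ℕ)
    (huv : ∀ i < h, u i = v i) : ctraj φ x₁ u h = ctraj φ x₁ v h := by
  induction h with
  | zero => rfl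
  | succ h ih =>
    simp only [ctraj]
    rw [ih fun i hi => huv i (by omega), huv h (by omega)]

/-- The controls played along the closed-loop trajectory. -/
def ctrl {X U Θ : Type*} [Add U] (φ : X → U → X) (π : ℕ → X → Θ → U)
    (x₁ : X) (w : ℕ → U) (θ : Θ) (h : ℕ) : U :=
  π h (traj φ π x₁ w θ h) θ + w h

theorem traj_eq_ctraj {X U Θ : Type*} [Add U] (φ : X → U → X) (π : ℕ → X → Θ → U)
    (x₁ : X) (w : ℕ → U) (θ : Θ) (h : ℕ) :
    traj φ π x₁ w θ h = ctraj φ x₁ (ctrl φ π x₁ w θ) h := by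
  induction h with
  | zero => rfl
  | succ h ih =>
    simp only [ctraj, traj]
    rw [← ih]
    rfl

section Main

variable {X U Θ : Type*} [NormedAddCommGroup X] [NormedSpace ℝ X]
  [NormedAddCommGroup U] [NormedSpace ℝ U] [NormedAddCommGroup Θ] [NormedSpace ℝ Θ]

theorem PL_extNoise {H : ℕ} (h : ℕ) : PL (fun w : Fin H → U => extNoise w h) := by
  unfold extNoise
  by_cases hh : h < H
  · simp only [hh, dite_true]
    exact PL.clm (ContinuousLinearMap.proj (R := ℝ) (φ := fun _ : Fin H => U) ⟨h, hh⟩)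
  · simp only [hh, dite_false]
    exact PL.const 0

theorem PL_fst : PL (fun q : X × U => q.1) := PL.clm (ContinuousLinearMap.fst ℝ X U)

theorem PL_snd : PL (fun q : X × U => q.2) := PL.clm (ContinuousLinearMap.snd ℝ X U)

theorem PL_ctraj {H : ℕ} {φ : X → U → X} (hφ : PL (fun q : X × U => φ q.1 q.2)) (x₁ : X) (h : ℕ) :
    PL (fun u : Fin H → U => ctraj φ x₁ (extNoise u) h) := by
  induction h with
  | zero => exact PL.const x₁
  | succ h ih => exact hφ.comp (ih.prodMk (PL_extNoise h))

theorem PL_traj {H : ℕ} {φ : X → U → X} (hφ : PL (fun q : X × U => φ q.1 q.2))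
    {π : ℕ → X → Θ → U} (hπ : ∀ h, PL (fun q : X × Θ => π h q.1 q.2)) (x₁ : X) (h : ℕ) :
    PL (fun z : (Fin H → U) × Θ => traj φ π x₁ (extNoise z.1) z.2 h) := by
  induction h with
  | zero => exact PL.const x₁
  | succ h ih =>
    exact hφ.comp (ih.prodMk (((hπ h).comp (ih.prodMk PL_snd)).add ((PL_extNoise h).comp PL_fst)))

theorem PL_cost {H : ℕ} {φ : X → U → X} (hφ : PL (fun q : X × U => φ q.1 q.2))
    {π : ℕ → X → Θ → U} (hπ : ∀ h, PL (fun q : X × Θ => π h q.1 q.2))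
    {c : ℕ → X → U → ℝ} (hc : ∀ h, PL (fun q : X × U => c h q.1 q.2)) (x₁ : X) :
    PL (fun z : (Fin H → U) × Θ => cost2go φ π c H x₁ (extNoise z.1) z.2 0) := by
  unfold cost2go
  refine PL.sum _ fun h => ?_
  have ih := PL_traj (H := H) hφ hπ x₁ h
  exact (hc h).comp
    (ih.prodMk (((hπ h).comp (ih.prodMk PL_snd)).add ((PL_extNoise h).comp PL_fst)))

theorem extNoise_of_lt {H : ℕ} (u : Fin H → U) {h : ℕ} (hh : h < H) :
    extNoise u h = u ⟨h, hh⟩ := by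
  simp [extNoise, hh]

theorem ctraj_ctrl {H : ℕ} (φ : X → U → X) (π : ℕ → X → Θ → U)
    (x₁ : X) (w : Fin H → U) (θ : Θ) {h : ℕ} (hh : h ≤ H) :
    ctraj φ x₁ (extNoise fun i : Fin H => ctrl φ π x₁ (extNoise w) θ i) h =
      traj φ π x₁ (extNoise w) θ h := by
  rw [traj_eq_ctraj]
  apply ctraj_congr
  intro i hi
  rw [extNoise_of_lt _ (lt_of_lt_of_le hi hh)]

/-- Pathwise differentiability of states, given differentiability of the open-loop map at the
control sequence. -/
theorem traj_diff {H : ℕ} {φ : X → U → X}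
    {π : ℕ → X → Θ → U} (hπ : ∀ h, Differentiable ℝ (fun q : X × Θ => π h q.1 q.2))
    (x₁ : X) (w : Fin H → U) (θ : Θ)
    (hd : ∀ h : Fin H, DifferentiableAt ℝ (fun u : Fin H → U => ctraj φ x₁ (extNoise u) h)
      (fun i : Fin H => ctrl φ π x₁ (extNoise w) θ i)) (h : ℕ) (hh : h < H) :
    DifferentiableAt ℝ (fun θ' => traj φ π x₁ (extNoise w) θ' h) θ := by
  induction h using Nat.strong_induction_on with
  | _ h ih =>
  have hc : ∀ i < h, DifferentiableAt ℝ (fun θ' => ctrl φ π x₁ (extNoise w) θ' i) θ := by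
    intro i hi
    have h1 := ih i hi (hi.trans hh)
    unfold ctrl
    have h2 : DifferentiableAt ℝ (fun θ' => (traj φ π x₁ (extNoise w) θ' i, θ')) θ :=
      h1.prodMk differentiableAt_id
    exact (DifferentiableAt.comp (f := fun θ' => (traj φ π x₁ (extNoise w) θ' i, θ')) θ
      (hπ i _) h2).add_const _
  let v : Θ → Fin H → U := fun θ' i =>
    if (i : ℕ) < h then ctrl φ π x₁ (extNoise w) θ' i else ctrl φ π x₁ (extNoise w) θ i
  have hv : DifferentiableAt ℝ v θ := by
    rw [differentiableAt_pi]
    intro i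
    by_cases hi : (i : ℕ) < h
    · simpa [v, hi] using hc i hi
    · simp [v, hi]
  have hv0 : v θ = fun i : Fin H => ctrl φ π x₁ (extNoise w) θ i := by
    funext i
    simp [v]
  have heq : (fun θ' => traj φ π x₁ (extNoise w) θ' h) =
      (fun u : Fin H → U => ctraj φ x₁ (extNoise u) h) ∘ v := by
    funext θ'
    simp only [Function.comp]
    rw [traj_eq_ctraj]
    apply ctraj_congr
    intro i hi
    rw [extNoise_of_lt _ (hi.trans hh)]
    simp [v, hi]
  rw [heq]
  refine DifferentiableAt.comp θ ?_ hv
  rw [hv0]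
  exact hd ⟨h, hh⟩

theorem cost_diff {H : ℕ} {φ : X → U → X}
    {π : ℕ → X → Θ → U} (hπ : ∀ h, Differentiable ℝ (fun q : X × Θ => π h q.1 q.2))
    {c : ℕ → X → U → ℝ} (hc : ∀ h, Differentiable ℝ (fun q : X × U => c h q.1 q.2))
    (x₁ : X) (w : Fin H → U) (θ : Θ)
    (hd : ∀ h : Fin H, DifferentiableAt ℝ (fun u : Fin H → U => ctraj φ x₁ (extNoise u) h)
      (fun i : Fin H => ctrl φ π x₁ (extNoise w) θ i)) :
    DifferentiableAt ℝ (fun θ' => cost2go φ π c H x₁ (extNoise w) θ' 0) θ := by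
  unfold cost2go
  refine DifferentiableAt.fun_sum fun h hh => ?_
  have hh' : h < H := (Finset.mem_Ico.1 hh).2
  have h1 := traj_diff hπ x₁ w θ hd h hh'
  have h2 : DifferentiableAt ℝ (fun θ' => π h (traj φ π x₁ (extNoise w) θ' h) θ' + extNoise w h) θ :=
    (DifferentiableAt.comp (f := fun θ' => (traj φ π x₁ (extNoise w) θ' h, θ')) θ
      (hπ h _) (h1.prodMk differentiableAt_id)).add_const _
  exact DifferentiableAt.comp (f := fun θ' => (traj φ π x₁ (extNoise w) θ' h,
    π h (traj φ π x₁ (extNoise w) θ' h) θ' + extNoise w h)) θ (hc h _) (h1.prodMk h2)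

/-- Almost every noise sequence gives controls at which all open-loop maps are differentiable. -/
theorem ae_good {H : ℕ} [FiniteDimensional ℝ X] [FiniteDimensional ℝ U]
    [MeasurableSpace U] [BorelSpace U] (μ : Measure (Fin H → U)) [μ.IsAddHaarMeasure]
    {φ : X → U → X} (hφ : PL (fun q : X × U => φ q.1 q.2))
    {π : ℕ → X → Θ → U} (hπ : ∀ h, PL (fun q : X × Θ => π h q.1 q.2)) (x₁ : X) (θ : Θ) :
    ∀ᵐ w ∂μ, ∀ h : Fin H, DifferentiableAt ℝ (fun u : Fin H → U => ctraj φ x₁ (extNoise u) h)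
      (fun i : Fin H => ctrl φ π x₁ (extNoise w) θ i) := by
  have h1 : ∀ᵐ u ∂μ, ∀ h : Fin H,
      DifferentiableAt ℝ (fun u : Fin H → U => ctraj φ x₁ (extNoise u) h) u := by
    rw [ae_all_iff]
    exact fun h => (PL_ctraj hφ x₁ h).ae_differentiableAt μ
  let S : (Fin H → U) → (Fin H → U) := fun u i =>
    extNoise u i + -(π i (ctraj φ x₁ (extNoise u) i) θ)
  have hS : PL S := PL.pi (f := fun (i : Fin H) (u : Fin H → U) =>
      extNoise u i + -(π i (ctraj φ x₁ (extNoise u) i) θ)) fun i =>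
    (PL_extNoise (i : ℕ)).add ((hπ i).comp ((PL_ctraj hφ x₁ i).prodMk (PL.const θ))).neg
  rw [ae_iff] at h1 ⊢
  refine measure_mono_null ?_ (hS.image_null μ h1)
  intro w hw
  refine ⟨fun i : Fin H => ctrl φ π x₁ (extNoise w) θ i, hw, ?_⟩
  funext i
  simp only [S]
  rw [ctraj_ctrl φ π x₁ w θ i.2.le, extNoise_of_lt _ i.2]
  simp [ctrl, extNoise_of_lt w i.2]

end Main

/-- unbiasedness of the first-order (pathwise) gradient estimator for a
benign Lipschitz planning problem with deterministic initial state. For every `θ` there is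
a Lebesgue-measurable set `Z` of noise sequences with probability one on which
`θ' ↦ V₁(x₁, w_{1:H}, θ')` is differentiable at `θ`, and
`∇F(θ) = E_{w_{1:H}∼p^H}[∇_θ V₁(x₁, w_{1:H}, θ)]`, the integrand being set to `0` off `Z`. -/
theorem benign_lipschitz_fobg_unbiased {n m d H : ℕ}
    (p : Measure (EuclideanSpace ℝ (Fin m))) [IsProbabilityMeasure p]
    (ψ : EuclideanSpace ℝ (Fin m) → ℝ) (αc a b : ℝ) (ha : 0 < a)
    (hp : p = volume.withDensity fun w => ENNReal.ofReal (Real.exp (αc - ψ w)))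
    (hψlb : ∀ w, a * ‖w‖ - b ≤ ψ w)
    (hψ1 : Differentiable ℝ ψ)
    (hψ2 : Differentiable ℝ (fun w => fderiv ℝ ψ w))
    (hψ3 : PolyGrowth (fun w => fderiv ℝ (fun w' => fderiv ℝ ψ w') w))
    (φ : EuclideanSpace ℝ (Fin n) → EuclideanSpace ℝ (Fin m) → EuclideanSpace ℝ (Fin n))
    (hφm : Measurable (fun q : EuclideanSpace ℝ (Fin n) × EuclideanSpace ℝ (Fin m) =>
      φ q.1 q.2))
    (hφg : PolyGrowth (fun q : EuclideanSpace ℝ (Fin n) × EuclideanSpace ℝ (Fin m) =>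
      φ q.1 q.2))
    (hφLip : PolyLipschitz (fun q : EuclideanSpace ℝ (Fin n) × EuclideanSpace ℝ (Fin m) =>
      φ q.1 q.2))
    (c : ℕ → EuclideanSpace ℝ (Fin n) → EuclideanSpace ℝ (Fin m) → ℝ)
    (hcg : ∀ h, PolyGrowth (fun q : EuclideanSpace ℝ (Fin n) × EuclideanSpace ℝ (Fin m) =>
      c h q.1 q.2))
    (hcd : ∀ h, Differentiable ℝ
      (fun q : EuclideanSpace ℝ (Fin n) × EuclideanSpace ℝ (Fin m) => c h q.1 q.2))
    (hcd' : ∀ h, PolyGrowth (fun q => fderiv ℝ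
      (fun q' : EuclideanSpace ℝ (Fin n) × EuclideanSpace ℝ (Fin m) => c h q'.1 q'.2) q))
    (π : ℕ → EuclideanSpace ℝ (Fin n) → EuclideanSpace ℝ (Fin d) → EuclideanSpace ℝ (Fin m))
    (hπd : ∀ h, Differentiable ℝ
      (fun q : EuclideanSpace ℝ (Fin n) × EuclideanSpace ℝ (Fin d) => π h q.1 q.2))
    (hπd' : ∀ h, PolyGrowth (fun q => fderiv ℝ
      (fun q' : EuclideanSpace ℝ (Fin n) × EuclideanSpace ℝ (Fin d) => π h q'.1 q'.2) q))
    (hπ2 : ∀ h x, Differentiable ℝ (fun θ => fderiv ℝ (π h x) θ))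
    (hπ3 : ∀ h θ, PolyGrowth (fun x => fderiv ℝ (fun θ' => fderiv ℝ (π h x) θ') θ))
    (x₁ : EuclideanSpace ℝ (Fin n)) :
    let μH : Measure (Fin H → EuclideanSpace ℝ (Fin m)) := Measure.pi fun _ : Fin H => p
    let F : EuclideanSpace ℝ (Fin d) → ℝ := fun θ =>
      ∫ w : Fin H → EuclideanSpace ℝ (Fin m), cost2go φ π c H x₁ (extNoise w) θ 0 ∂μH
    ∀ θ, ∃ Z : Set (Fin H → EuclideanSpace ℝ (Fin m)),
      NullMeasurableSet Z μH ∧ μH Z = 1 ∧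
      (∀ w ∈ Z, DifferentiableAt ℝ (fun θ' => cost2go φ π c H x₁ (extNoise w) θ' 0) θ) ∧
      DifferentiableAt ℝ F θ ∧
      gradient F θ = ∫ w : Fin H → EuclideanSpace ℝ (Fin m),
        Set.indicator Z
          (fun w' => gradient (fun θ' => cost2go φ π c H x₁ (extNoise w') θ' 0) θ) w ∂μH := by
  intro μH F θ
  have hφ := hφLip.toPL
  have hπ : ∀ h, PL (fun q : EuclideanSpace ℝ (Fin n) × EuclideanSpace ℝ (Fin d) =>
    π h q.1 q.2) := fun h => PL.of_fderiv (hπd h) (hπd' h)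
  have hc : ∀ h, PL (fun q : EuclideanSpace ℝ (Fin n) × EuclideanSpace ℝ (Fin m) =>
    c h q.1 q.2) := fun h => PL.of_fderiv (hcd h) (hcd' h)
  have hV := PL_cost (H := H) hφ hπ hc x₁
  have hVc : Continuous (Function.uncurry
      fun (w : Fin H → EuclideanSpace ℝ (Fin m)) (θ' : EuclideanSpace ℝ (Fin d)) =>
        cost2go φ π c H x₁ (extNoise w) θ' 0) := hV.continuous
  have hac : μH ≪ volume := by
    refine pi_ac p volume ?_ H
    rw [hp]
    exact withDensity_absolutelyContinuous _ _
  have hgood : ∀ᵐ w ∂μH,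
      DifferentiableAt ℝ (fun θ' => cost2go φ π c H x₁ (extNoise w) θ' 0) θ := by
    filter_upwards [hac.ae_le (ae_good volume hφ hπ x₁ θ)] with w hw
    exact cost_diff hπd hcd x₁ w θ hw
  let Z : Set (Fin H → EuclideanSpace ℝ (Fin m)) :=
    {w | DifferentiableAt ℝ (fun θ' => cost2go φ π c H x₁ (extNoise w) θ' 0) θ}
  have hZm : MeasurableSet Z :=
    (measurableSet_of_differentiableAt_with_param ℝ hVc).preimage
      (f := fun w => (w, θ)) (by fun_prop)
  have hF'm : Measurable (fun w : Fin H → EuclideanSpace ℝ (Fin m) =>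
      fderiv ℝ (fun θ' => cost2go φ π c H x₁ (extNoise w) θ' 0) θ) :=
    (measurable_fderiv_with_param ℝ hVc).comp (g := fun q => _) (f := fun w => (w, θ))
      (by fun_prop)
  have hmom := moments_pi (H := H) p (moments p ψ αc a b ha hp hψlb hψ1)
  have hVw : ∀ θ', Continuous fun w : Fin H → EuclideanSpace ℝ (Fin m) =>
      cost2go φ π c H x₁ (extNoise w) θ' 0 := fun θ' =>
    hVc.comp (f := fun w => (w, θ')) (by fun_prop)
  -- the radius controlling `(w, θ')` for `θ'` in the unit ball around `θ`
  have hR : ∀ w : Fin H → EuclideanSpace ℝ (Fin m), ∀ θ' ∈ Metric.ball θ 1,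
      ‖(w, θ')‖ ≤ (1 + ‖θ‖) * (1 + ‖w‖) := by
    intro w θ' hθ'
    have h1 : ‖θ'‖ ≤ ‖θ‖ + 1 := by
      have h2 : ‖θ' - θ‖ < 1 := by simpa [dist_eq_norm] using hθ'
      have h3 := norm_add_le (θ' - θ) θ
      rw [sub_add_cancel] at h3
      linarith
    rw [Prod.norm_mk]
    have := norm_nonneg w
    have := norm_nonneg θ
    exact max_le (by nlinarith) (by nlinarith)
  have hR1 : ∀ w : Fin H → EuclideanSpace ℝ (Fin m), 1 ≤ (1 + ‖θ‖) * (1 + ‖w‖) := fun w =>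
    one_le_mul_of_one_le_of_one_le (by simp) (by simp)
  obtain ⟨M, k, -, hgr⟩ := hV.growth
  obtain ⟨K, hlip⟩ := hV
  have hint : Integrable (fun w : Fin H → EuclideanSpace ℝ (Fin m) =>
      cost2go φ π c H x₁ (extNoise w) θ 0) μH := by
    refine ((hmom k).const_mul (M * (1 + ‖θ‖) ^ k)).mono' (hVw θ).aestronglyMeasurable
      (Filter.Eventually.of_forall fun w => ?_)
    refine (hgr _ (hR1 w) (w, θ) (hR w θ (by simp))).trans_eq ?_
    rw [mul_pow]
    ring
  have key := hasFDerivAt_integral_of_dominated_loc_of_lip' (𝕜 := ℝ) (μ := μH) (x₀ := θ)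
    (s := Metric.ball θ 1)
    (F := fun θ' w => cost2go φ π c H x₁ (extNoise w) θ' 0)
    (F' := fun w => fderiv ℝ (fun θ' => cost2go φ π c H x₁ (extNoise w) θ' 0) θ)
    (bound := fun w => (K * (1 + ‖θ‖) ^ K) * (1 + ‖w‖) ^ K)
    (Metric.ball_mem_nhds θ one_pos)
    (fun θ' _ => (hVw θ').aestronglyMeasurable) hint hF'm.aestronglyMeasurable
    (Filter.Eventually.of_forall fun w θ' hθ' => by
      refine (hlip _ (hR1 w) (w, θ') (w, θ) (hR w θ' hθ') (hR w θ (by simp))).trans_eq ?_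
      rw [Prod.mk_sub_mk, Prod.norm_mk, sub_self, norm_zero, max_eq_right (norm_nonneg _), mul_pow]
      ring)
    ((hmom K).const_mul _)
    (hgood.mono fun w hw => hw.hasFDerivAt)
  refine ⟨Z, hZm.nullMeasurableSet, (prob_compl_eq_zero_iff hZm).1 hgood, fun w hw => hw,
    key.2.differentiableAt, ?_⟩
  have hind : Z.indicator
      (fun w' => gradient (fun θ' => cost2go φ π c H x₁ (extNoise w') θ' 0) θ) =
      fun w' => gradient (fun θ' => cost2go φ π c H x₁ (extNoise w') θ' 0) θ := by
    funext w
    by_cases hw : w ∈ Z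
    · rw [Set.indicator_of_mem hw]
    · rw [Set.indicator_of_notMem hw, gradient, fderiv_zero_of_not_differentiableAt hw, map_zero]
  rw [hind]
  unfold gradient
  rw [key.2.fderiv]
  exact ((InnerProductSpace.toDual ℝ (EuclideanSpace ℝ (Fin d))).symm.toContinuousLinearEquiv.integral_comp_comm _).symm
end

section
/- Consider a planning problem with horizon H, noise w_1, …, w_H i.i.d. ∼ N(0, σ²I_m) on ℝ^m, a deterministic initial state x₁ ∈ ℝ^n, Borel-measurable dynamics generating x_{h+1} = φ(x_h, π(x_h, θ) + w_h) (so that each x_h is a measurable function of (x₁, w_{1:h−1})), a measurable value function V₁, and a policy π differentiable in θ. Suppose |V₁(x, w_{1:H}, θ)| ≤ B_V for all x, w_{1:H} and ‖D_θ π(x, θ)‖_op ≤ B_π for all x. Then the single-sample zeroth-order gradient estimate ĝ := (1/σ²) · V₁(x₁, w_{1:H}, θ) · Σ_{h=1}^H (D_θ π(x_h, θ))ᵀ w_h satisfies Var[ĝ] ≤ B_V² B_π² · H m / σ², and consequently the N-sample batched estimator (the average of N i.i.d. copies of ĝ) has variance at most B_V² B_π² H m / (N σ²). -/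
open MeasureTheory

/-- The density of the centered Gaussian measure `N(0, σ²I_m)` on `ℝ^m`. -/
noncomputable def gaussDensity (m : ℕ) (σ : ℝ) (w : EuclideanSpace ℝ (Fin m)) : ℝ :=
  (2 * Real.pi * σ ^ 2) ^ (-(m : ℝ) / 2) * Real.exp (-‖w‖ ^ 2 / (2 * σ ^ 2))

lemma extNoise_snoc {U : Type*} [Zero U] {H : ℕ} (w : Fin H → U) (v : U) (h : ℕ) (hh : h < H) :
    extNoise (Fin.snoc (α := fun _ => U) w v : Fin (H + 1) → U) h = extNoise w h := by
  have h2 : h < H + 1 := by omega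
  simp only [extNoise, hh, h2, dite_true]
  have : (⟨h, h2⟩ : Fin (H+1)) = Fin.castSucc ⟨h, hh⟩ := rfl
  rw [this, Fin.snoc_castSucc]

lemma core_step {E F : Type*} [MeasurableSpace E] [NormedAddCommGroup F]
    [InnerProductSpace ℝ F] [CompleteSpace F] (ν : Measure E) [IsProbabilityMeasure ν]
    (c : ℝ) (f : E → F) (hf : MemLp f 2 ν) (h0 : ∫ v, f v ∂ν = 0)
    (hc : ∫ v, ‖f v‖ ^ 2 ∂ν ≤ c) (A : F) :
    ∫⁻ v, ENNReal.ofReal (‖A + f v‖ ^ 2) ∂ν ≤ ENNReal.ofReal (‖A‖ ^ 2) + ENNReal.ofReal c := by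
  have hi : Integrable f ν := hf.integrable (by norm_num)
  have hsq : Integrable (fun v => ‖f v‖ ^ 2) ν := hf.integrable_norm_pow (by norm_num)
  have hin : Integrable (fun v => 2 * inner ℝ A (f v)) ν := (hi.const_inner A).const_mul 2
  have hc0 : 0 ≤ c := le_trans (integral_nonneg (fun v => by positivity)) hc
  have heq : (fun v => ‖A + f v‖ ^ 2) = fun v => (‖A‖ ^ 2 + 2 * inner ℝ A (f v)) + ‖f v‖ ^ 2 := by
    funext v; exact norm_add_sq_real A (f v)
  have hint : Integrable (fun v => ‖A + f v‖ ^ 2) ν := by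
    rw [heq]; exact ((integrable_const _).add hin).add hsq
  have hA : Integrable (fun v => ‖A‖ ^ 2 + 2 * inner ℝ A (f v)) ν := (integrable_const _).add hin
  rw [← ofReal_integral_eq_lintegral_ofReal hint (Filter.Eventually.of_forall fun v => by positivity),
    ← ENNReal.ofReal_add (by positivity) hc0]
  apply ENNReal.ofReal_le_ofReal
  rw [heq, integral_add hA hsq, integral_add (integrable_const _) hin,
    integral_const_mul, integral_inner hi, h0]
  simpa using hc

lemma core {E F : Type*} [MeasurableSpace E] [Zero E] [NormedAddCommGroup F]
    [InnerProductSpace ℝ F] [CompleteSpace F] (ν : Measure E) [IsProbabilityMeasure ν]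
    (c : ℝ) (f : ℕ → (ℕ → E) → E → F)
    (hcaus : ∀ h w w', (∀ k < h, w k = w' k) → f h w = f h w')
    (hf : ∀ h w, MemLp (f h w) 2 ν) (h0 : ∀ h w, ∫ v, f h w v ∂ν = 0)
    (hc : ∀ h w, ∫ v, ‖f h w v‖ ^ 2 ∂ν ≤ c) (H : ℕ) :
    ∫⁻ w : Fin H → E, ENNReal.ofReal (‖∑ h : Fin H, f h (extNoise w) (w h)‖ ^ 2)
      ∂(Measure.pi fun _ => ν) ≤ H * ENNReal.ofReal c := by
  induction H with
  | zero => simp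
  | succ H ih =>
    obtain ⟨g, hg, hle, hgeq⟩ := exists_measurable_le_lintegral_eq (Measure.pi fun _ : Fin (H+1) => ν)
      (fun w : Fin (H+1) → E => ENNReal.ofReal (‖∑ h : Fin (H+1), f h (extNoise w) (w h)‖ ^ 2))
    rw [hgeq]
    have mp := (measurePreserving_piFinSuccAbove (fun _ : Fin (H+1) => ν) (Fin.last H)).symm
    rw [← mp.lintegral_comp hg]
    have hg' : Measurable (fun p => g ((MeasurableEquiv.piFinSuccAbove (fun _ : Fin (H+1) => E) (Fin.last H)).symm p)) :=
      hg.comp (MeasurableEquiv.measurable _)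
    rw [lintegral_prod_symm' _ hg']
    set G : (Fin H → E) → ENNReal := fun w => ∫⁻ v, g ((MeasurableEquiv.piFinSuccAbove (fun _ : Fin (H+1) => E) (Fin.last H)).symm (v, w)) ∂ν with hG
    have hGm : Measurable G := hg'.lintegral_prod_left'
    have hGle : ∀ w, G w ≤ ENNReal.ofReal (‖∑ h : Fin H, f h (extNoise w) (w h)‖ ^ 2) + ENNReal.ofReal c := by
      intro w
      refine le_trans (lintegral_mono (fun v => (hle _).trans (le_of_eq ?_)))
        (core_step ν c (f H (extNoise w)) (hf _ _) (h0 _ _) (hc _ _) _)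
      have e1 : (MeasurableEquiv.piFinSuccAbove (fun _ : Fin (H+1) => E) (Fin.last H)).symm (v, w)
          = (Fin.snoc (α := fun _ => E) w v : Fin (H+1) → E) := by
        simp [MeasurableEquiv.piFinSuccAbove, Fin.insertNthEquiv, Fin.insertNth_last']
      dsimp only
      rw [e1, Fin.sum_univ_castSucc]
      simp only [Fin.snoc_castSucc, Fin.snoc_last, Fin.val_castSucc, Fin.val_last]
      rw [hcaus H _ (extNoise w) (fun k hk => extNoise_snoc w v k hk)]
      congr 4
      refine Finset.sum_congr rfl fun h _ => ?_
      rw [hcaus h _ (extNoise w) (fun k hk => extNoise_snoc w v k (hk.trans h.2))]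
    calc ∫⁻ w, G w ∂(Measure.pi fun _ => ν)
        ≤ ∫⁻ w, ((G w - ENNReal.ofReal c) + ENNReal.ofReal c) ∂(Measure.pi fun _ => ν) :=
          lintegral_mono fun w => le_tsub_add
      _ = ∫⁻ w, (G w - ENNReal.ofReal c) ∂(Measure.pi fun _ => ν) + ENNReal.ofReal c := by
          rw [lintegral_add_right _ measurable_const]; simp
      _ ≤ H * ENNReal.ofReal c + ENNReal.ofReal c := by
          gcongr
          refine le_trans (lintegral_mono fun w => ?_) ih
          exact tsub_le_iff_right.2 (hGle w)
      _ = _ := by push_cast; ring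

lemma aesm_of_norm {Ω F : Type*} [MeasurableSpace Ω] [NormedAddCommGroup F]
    [InnerProductSpace ℝ F] [FiniteDimensional ℝ F] (μ : Measure Ω) [IsProbabilityMeasure μ]
    (g : Ω → F) (h : AEStronglyMeasurable (fun p : Ω × Ω => ‖g p.1 + g p.2‖ ^ 2) (μ.prod μ)) :
    AEStronglyMeasurable g μ := by
  have hY : ∀ᵐ y ∂μ, AEStronglyMeasurable (fun x => ‖g y + g x‖ ^ 2) μ := h.prodMk_left
  obtain ⟨y0, hy0⟩ := hY.exists
  set Y : Set Ω := {y | AEStronglyMeasurable (fun x => ‖g y + g x‖ ^ 2) μ} with hYdef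
  set U : Submodule ℝ F := Submodule.span ℝ ((fun y => g y - g y0) '' Y) with hU
  have key : ∀ u ∈ U, AEStronglyMeasurable (fun x => inner ℝ u (g x)) μ := by
    intro u hu
    induction hu using Submodule.span_induction with
    | mem u hu =>
      obtain ⟨y, hy, rfl⟩ := hu
      have h1 : (fun x => inner ℝ (g y - g y0) (g x)) = fun x =>
          2⁻¹ * ((‖g y + g x‖ ^ 2 - ‖g y0 + g x‖ ^ 2) - (‖g y‖ ^ 2 - ‖g y0‖ ^ 2)) := by
        funext x
        rw [norm_add_sq_real, norm_add_sq_real, inner_sub_left]; ring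
      change AEStronglyMeasurable (fun x => inner ℝ (g y - g y0) (g x)) μ
      rw [h1]
      exact ((AEStronglyMeasurable.sub hy hy0).sub aestronglyMeasurable_const).const_mul _
    | zero => simpa using aestronglyMeasurable_const
    | add u v _ _ hu hv => simp only [inner_add_left]; exact hu.add hv
    | smul a u _ hu => simp only [inner_smul_left]; exact hu.const_mul _
  let b := stdOrthonormalBasis ℝ U
  have hmeas : AEStronglyMeasurable
      (fun x => g y0 + ∑ i, (inner ℝ (b i : F) (g x) - inner ℝ (b i : F) (g y0)) • (b i : F)) μ := by
    refine aestronglyMeasurable_const.add (Finset.aestronglyMeasurable_fun_sum _ fun i _ => ?_)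
    exact ((key _ (b i).2).sub aestronglyMeasurable_const).smul_const _
  refine hmeas.congr ?_
  filter_upwards [hY] with x hx
  have hxU : g x - g y0 ∈ U := Submodule.subset_span ⟨x, hx, rfl⟩
  have h2 := congrArg (Subtype.val) (b.sum_repr' ⟨g x - g y0, hxU⟩)
  simp only [Submodule.coe_sum, Submodule.coe_smul, Submodule.coe_inner, inner_sub_right] at h2
  rw [h2]; abel

lemma aesm_of_batch {Ω F : Type*} [MeasurableSpace Ω] [NormedAddCommGroup F]
    [InnerProductSpace ℝ F] [FiniteDimensional ℝ F] (μ : Measure Ω) [IsProbabilityMeasure μ]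
    (g : Ω → F) (k : ℕ) (a : ℝ) (ha : a ≠ 0) (c : F)
    (h : AEStronglyMeasurable (fun W : Fin (k+2) → Ω => ‖a • ∑ i, g (W i) - c‖ ^ 2)
      (Measure.pi fun _ => μ)) :
    AEStronglyMeasurable g μ := by
  have mp := (measurePreserving_piFinSuccAbove (fun _ : Fin (k+2) => μ) 0).symm
  have mp2 := (measurePreserving_piFinSuccAbove (fun _ : Fin (k+1) => μ) 0).symm
  have h1 := h.comp_measurePreserving mp
  have h2 := h1.comp_measurePreserving ((MeasurePreserving.id μ).prod mp2)
  have h3 := h2.comp_measurePreserving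
    (measurePreserving_prodAssoc μ μ (Measure.pi fun _ : Fin k => μ))
  obtain ⟨r, hr⟩ := h3.prod_swap.prodMk_left.exists
  let g' : Ω → F := fun x => a • g x + (2⁻¹ : ℝ) • (a • ∑ i, g (r i) - c)
  have hg' : AEStronglyMeasurable g' μ := by
    apply aesm_of_norm
    refine hr.congr (Filter.Eventually.of_forall fun p => ?_)
    simp [g', MeasurableEquiv.piFinSuccAbove, Fin.insertNthEquiv, Fin.sum_univ_succ,
      MeasurableEquiv.prodAssoc]
    congr 2
    module
  have : g = fun x => a⁻¹ • (g' x - (2⁻¹ : ℝ) • (a • ∑ i, g (r i) - c)) := by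
    funext x; simp [g', smul_smul, ha]
  rw [this]
  exact (hg'.sub aestronglyMeasurable_const).const_smul _

lemma integral_le_of_lint {Ω : Type*} [MeasurableSpace Ω] (μ : Measure Ω) (f : Ω → ℝ)
    (hf : ∀ x, 0 ≤ f x) (R : ℝ) (hR : 0 ≤ R) (h : ∫⁻ x, ENNReal.ofReal (f x) ∂μ ≤ ENNReal.ofReal R) :
    ∫ x, f x ∂μ ≤ R := by
  by_cases hm : AEStronglyMeasurable f μ
  · rw [integral_eq_lintegral_of_nonneg_ae (Filter.Eventually.of_forall hf) hm]
    exact ENNReal.toReal_le_of_le_ofReal hR h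
  · rw [integral_undef (fun hi => hm hi.1)]
    exact hR

lemma memLp_of_lint {Ω F : Type*} [MeasurableSpace Ω] (μ : Measure Ω) [NormedAddCommGroup F]
    (g : Ω → F) (R : ℝ) (hg : AEStronglyMeasurable g μ)
    (h : ∫⁻ x, ENNReal.ofReal (‖g x‖ ^ 2) ∂μ ≤ ENNReal.ofReal R) : MemLp g 2 μ := by
  rw [memLp_two_iff_integrable_sq_norm hg]
  refine ⟨(hg.norm.pow 2), ?_⟩
  rw [hasFiniteIntegral_iff_ofReal (Filter.Eventually.of_forall fun x => by positivity)]
  exact h.trans_lt ENNReal.ofReal_lt_top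

lemma var_single {Ω F : Type*} [MeasurableSpace Ω] (μ : Measure Ω) [IsProbabilityMeasure μ]
    [NormedAddCommGroup F] [InnerProductSpace ℝ F] [CompleteSpace F]
    (g : Ω → F) (R : ℝ) (hR : 0 ≤ R)
    (h : ∫⁻ x, ENNReal.ofReal (‖g x‖ ^ 2) ∂μ ≤ ENNReal.ofReal R) :
    ∫ x, ‖g x - ∫ y, g y ∂μ‖ ^ 2 ∂μ ≤ R := by
  have h2 := integral_le_of_lint μ _ (fun x => by positivity) R hR h
  by_cases hg : AEStronglyMeasurable g μ
  · have hL := memLp_of_lint μ g R hg h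
    have hi : Integrable g μ := hL.integrable (by norm_num)
    have hsq : Integrable (fun v => ‖g v‖ ^ 2) μ := hL.integrable_norm_pow (by norm_num)
    set c := ∫ y, g y ∂μ with hc
    have hin : Integrable (fun v => 2 * inner ℝ c (g v)) μ := (hi.const_inner c).const_mul 2
    have hA : Integrable (fun v => ‖g v‖ ^ 2 - 2 * inner ℝ c (g v)) μ := hsq.sub hin
    have heq : (fun v => ‖g v - c‖ ^ 2) = fun v => (‖g v‖ ^ 2 - 2 * inner ℝ c (g v)) + ‖c‖ ^ 2 := by
      funext v; rw [norm_sub_sq_real, real_inner_comm]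
    rw [heq, integral_add hA (integrable_const _), integral_sub hsq hin, integral_const_mul,
      integral_inner hi, ← hc, real_inner_self_eq_norm_sq]
    simp only [integral_const, probReal_univ, one_smul]
    nlinarith [sq_nonneg ‖c‖]
  · rw [integral_undef (fun hi => hg hi.1)]
    simpa using h2

lemma var_batch {Ω F : Type*} [MeasurableSpace Ω] [Zero Ω] (μ : Measure Ω) [IsProbabilityMeasure μ]
    [NormedAddCommGroup F] [InnerProductSpace ℝ F] [FiniteDimensional ℝ F]
    (g : Ω → F) (R : ℝ) (hR : 0 ≤ R)
    (h : ∫⁻ x, ENNReal.ofReal (‖g x‖ ^ 2) ∂μ ≤ ENNReal.ofReal R) (N : ℕ) (hN : 0 < N) :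
    ∫ W : Fin N → Ω, ‖(N : ℝ)⁻¹ • ∑ i : Fin N, g (W i) -
        ∫ W' : Fin N → Ω, (N : ℝ)⁻¹ • ∑ i : Fin N, g (W' i) ∂(Measure.pi fun _ : Fin N => μ)‖ ^ 2
        ∂(Measure.pi fun _ : Fin N => μ) ≤ R / N := by
  have : CompleteSpace F := FiniteDimensional.complete ℝ F
  have hN' : (0 : ℝ) < N := by exact_mod_cast hN
  by_cases hg : AEStronglyMeasurable g μ
  · have hL := memLp_of_lint μ g R hg h
    have hi : Integrable g μ := hL.integrable (by norm_num)
    set c := ∫ y, g y ∂μ with hc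
    have hmp : ∀ i : Fin N, MeasurePreserving (Function.eval i)
        (Measure.pi fun _ : Fin N => μ) μ := fun i => measurePreserving_eval (fun _ : Fin N => μ) i
    have hcomp : ∀ i : Fin N, Integrable (fun W : Fin N → Ω => g (W i))
        (Measure.pi fun _ : Fin N => μ) := fun i => (hmp i).integrable_comp_of_integrable hi
    have hmean : ∫ W' : Fin N → Ω, (N : ℝ)⁻¹ • ∑ i : Fin N, g (W' i)
        ∂(Measure.pi fun _ : Fin N => μ) = c := by
      rw [integral_smul, integral_finsetSum _ (fun i _ => hcomp i)]
      have : ∀ i : Fin N, ∫ W : Fin N → Ω, g (W i) ∂(Measure.pi fun _ : Fin N => μ) = c := by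
        intro i
        have h5 := integral_map (f := g) (hmp i).measurable.aemeasurable
          (by rw [(hmp i).map_eq]; exact hg)
        rw [(hmp i).map_eq] at h5
        exact h5.symm
      simp only [this, Finset.sum_const, Finset.card_univ, Fintype.card_fin]
      rw [← Nat.cast_smul_eq_nsmul ℝ, smul_smul, inv_mul_cancel₀ hN'.ne', one_smul]
    rw [hmean]
    have hcore := core μ R (fun _ _ v => g v - c) (fun _ _ _ _ => rfl)
      (fun _ _ => hL.sub (memLp_const c))
      (fun _ _ => by rw [integral_sub hi (integrable_const _)]; simp [hc])
      (fun _ _ => var_single μ g R hR h) N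
    have hNR : (N : ENNReal) * ENNReal.ofReal R = ENNReal.ofReal (N * R) := by
      rw [ENNReal.ofReal_mul hN'.le, ENNReal.ofReal_natCast]
    rw [hNR] at hcore
    have h3 := integral_le_of_lint _ _ (fun x => by positivity) _ (by positivity) hcore
    have heq : ∀ W : Fin N → Ω, ‖(N : ℝ)⁻¹ • ∑ i : Fin N, g (W i) - c‖ ^ 2
        = ((N : ℝ)⁻¹) ^ 2 * ‖∑ i : Fin N, (g (W i) - c)‖ ^ 2 := by
      intro W
      have : (N : ℝ)⁻¹ • ∑ i : Fin N, g (W i) - c = (N : ℝ)⁻¹ • ∑ i : Fin N, (g (W i) - c) := by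
        rw [Finset.sum_sub_distrib, smul_sub]
        simp only [Finset.sum_const, Finset.card_univ, Fintype.card_fin]
        rw [← Nat.cast_smul_eq_nsmul ℝ, smul_smul, inv_mul_cancel₀ hN'.ne', one_smul]
      rw [this, norm_smul, mul_pow, Real.norm_of_nonneg (by positivity)]
    simp only [heq]
    rw [integral_const_mul]
    calc _ ≤ ((N : ℝ)⁻¹) ^ 2 * (N * R) := by gcongr
      _ = R / N := by field_simp
  · match N, hN with
    | 1, _ =>
      have mp : MeasurePreserving (MeasurableEquiv.funUnique (Fin 1) Ω)
          (Measure.pi fun _ : Fin 1 => μ) μ := by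
        convert measurePreserving_funUnique μ (Fin 1)
      have e1 := mp.integral_comp' (g := g)
      have e2 := mp.integral_comp' (g := fun x => ‖g x - ∫ y, g y ∂μ‖ ^ 2)
      have e3 := var_single μ g R hR h
      simp [MeasurableEquiv.funUnique] at e1 e2 ⊢
      rw [e1, e2]
      exact e3
    | k + 2, _ =>
      rw [integral_undef]
      · positivity
      · intro hi
        exact hg (aesm_of_batch μ g k _ (by positivity) _ hi.1)

lemma gauss_meas (m : ℕ) (σ : ℝ) : Measurable (gaussDensity m σ) := by
  unfold gaussDensity; fun_prop

lemma gauss_exp (m : ℕ) (σ : ℝ) (hσ : 0 < σ) (t : ℝ) (ht : 0 < 1 - 2 * σ ^ 2 * t) :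
    ∫⁻ w, ENNReal.ofReal (Real.exp (t * ‖w‖ ^ 2))
      ∂((volume : Measure (EuclideanSpace ℝ (Fin m))).withDensity
        fun w => ENNReal.ofReal (gaussDensity m σ w))
    = ENNReal.ofReal ((1 - 2 * σ ^ 2 * t) ^ (-(m : ℝ) / 2)) := by
  rw [lintegral_withDensity_eq_lintegral_mul _ (gauss_meas m σ).ennreal_ofReal (by fun_prop)]
  have hb : 0 < (1 - 2 * σ ^ 2 * t) / (2 * σ ^ 2) := by positivity
  set b := (1 - 2 * σ ^ 2 * t) / (2 * σ ^ 2) with hbdef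
  have hI := GaussianFourier.integral_rexp_neg_mul_sq_norm (V := EuclideanSpace ℝ (Fin m)) hb
  have hint : Integrable (fun v : EuclideanSpace ℝ (Fin m) => Real.exp (-b * ‖v‖ ^ 2)) := by
    apply Integrable.of_integral_ne_zero
    rw [hI]; positivity
  have heq : ∀ w : EuclideanSpace ℝ (Fin m),
      ENNReal.ofReal (gaussDensity m σ w) * ENNReal.ofReal (Real.exp (t * ‖w‖ ^ 2))
      = ENNReal.ofReal ((2 * Real.pi * σ ^ 2) ^ (-(m : ℝ) / 2) * Real.exp (-b * ‖w‖ ^ 2)) := by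
    intro w
    rw [← ENNReal.ofReal_mul (by unfold gaussDensity; positivity), gaussDensity, mul_assoc,
      ← Real.exp_add]
    congr 3
    rw [hbdef]; field_simp; ring
  simp only [Pi.mul_apply, heq]
  rw [← ofReal_integral_eq_lintegral_ofReal (hint.const_mul _)
    (Filter.Eventually.of_forall fun v => by positivity), integral_const_mul, hI]
  congr 1
  have : Real.pi / b = (2 * Real.pi * σ ^ 2) * (1 - 2 * σ ^ 2 * t)⁻¹ := by
    rw [hbdef]; field_simp
  have h0 : (0 : ℝ) < 2 * Real.pi * σ ^ 2 := by positivity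
  rw [this, Real.mul_rpow h0.le (inv_nonneg.2 ht.le), ← mul_assoc,
    ← Real.rpow_add h0, Real.inv_rpow ht.le, ← Real.rpow_neg ht.le]
  simp [neg_div]

lemma gauss_prob (m : ℕ) (σ : ℝ) (hσ : 0 < σ) :
    IsProbabilityMeasure ((volume : Measure (EuclideanSpace ℝ (Fin m))).withDensity
        fun w => ENNReal.ofReal (gaussDensity m σ w)) := by
  refine ⟨?_⟩
  have := gauss_exp m σ hσ 0 (by norm_num)
  simpa using this

lemma gauss_second (m : ℕ) (σ : ℝ) (hσ : 0 < σ) :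
    ∫⁻ w, ENNReal.ofReal (‖w‖ ^ 2)
      ∂((volume : Measure (EuclideanSpace ℝ (Fin m))).withDensity
        fun w => ENNReal.ofReal (gaussDensity m σ w)) ≤ ENNReal.ofReal (m * σ ^ 2) := by
  have hp := gauss_prob m σ hσ
  set γ := ((volume : Measure (EuclideanSpace ℝ (Fin m))).withDensity
        fun w => ENNReal.ofReal (gaussDensity m σ w)) with hγ
  set L := ∫⁻ w, ENNReal.ofReal (‖w‖ ^ 2) ∂γ with hL
  have key : ∀ t : ℝ, 0 < t → 0 < 1 - 2 * σ ^ 2 * t →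
      1 + ENNReal.ofReal t * L ≤ ENNReal.ofReal ((1 - 2 * σ ^ 2 * t) ^ (-(m : ℝ) / 2)) := by
    intro t ht ht1
    rw [← gauss_exp m σ hσ t ht1, ← hγ, hL, ← lintegral_const_mul _ (by fun_prop)]
    have : (1 : ENNReal) = ∫⁻ _, 1 ∂γ := by simp
    nth_rewrite 1 [this]
    rw [← lintegral_add_left measurable_const]
    refine lintegral_mono fun w => ?_
    rw [← ENNReal.ofReal_mul ht.le, ← ENNReal.ofReal_one, ← ENNReal.ofReal_add (by norm_num) (by positivity)]
    apply ENNReal.ofReal_le_ofReal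
    linarith [Real.add_one_le_exp (t * ‖w‖ ^ 2)]
  have hσ2 : 0 < σ ^ 2 := by positivity
  have hfin : L ≠ ⊤ := by
    intro htop
    have h1 := key (1 / (4 * σ ^ 2)) (by positivity) (by field_simp; norm_num)
    rw [htop, ENNReal.mul_top (by simpa using by positivity)] at h1
    simp at h1
  rw [← ENNReal.ofReal_toReal hfin]
  apply ENNReal.ofReal_le_ofReal
  have hder : HasDerivAt (fun t : ℝ => (1 - 2 * σ ^ 2 * t) ^ (-(m : ℝ) / 2)) (m * σ ^ 2) 0 := by
    have h1 : HasDerivAt (fun t : ℝ => 1 - 2 * σ ^ 2 * t) (-(2 * σ ^ 2)) 0 := by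
      simpa using ((hasDerivAt_id (0 : ℝ)).const_mul (2 * σ ^ 2)).const_sub 1
    have h2 := h1.rpow_const (p := -(m : ℝ) / 2) (Or.inl (by norm_num))
    convert h2 using 1
    simp; ring
  have hsl := (hasDerivAt_iff_tendsto_slope.1 hder).mono_left
    (nhdsWithin_mono 0 (fun x (hx : (0:ℝ) < x) => hx.ne') : nhdsWithin (0:ℝ) (Set.Ioi 0) ≤ _)
  refine ge_of_tendsto hsl ?_
  have hmem : Set.Ioo (0 : ℝ) (1 / (2 * σ ^ 2)) ∈ nhdsWithin (0:ℝ) (Set.Ioi 0) :=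
    Ioo_mem_nhdsGT (by positivity)
  filter_upwards [hmem] with t ht
  have ht1 : 0 < 1 - 2 * σ ^ 2 * t := by
    have := ht.2; rw [lt_div_iff₀ (by positivity)] at this; linarith
  have hk := key t ht.1 ht1
  rw [← ENNReal.ofReal_toReal hfin, ← ENNReal.ofReal_mul ht.1.le, ← ENNReal.ofReal_one,
    ← ENNReal.ofReal_add (by norm_num) (by have := ht.1; positivity),
    ENNReal.ofReal_le_ofReal_iff (by positivity)] at hk
  rw [slope_def_field, le_div_iff₀ (by linarith [ht.1])]
  simp
  linarith

lemma gauss_mean (m : ℕ) (σ : ℝ) :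
    ∫ w, w ∂((volume : Measure (EuclideanSpace ℝ (Fin m))).withDensity
        fun w => ENNReal.ofReal (gaussDensity m σ w)) = 0 := by
  rw [integral_withDensity_eq_integral_toReal_smul (gauss_meas m σ).ennreal_ofReal
    (Filter.Eventually.of_forall fun _ => ENNReal.ofReal_lt_top)]
  set I := ∫ x : EuclideanSpace ℝ (Fin m), (ENNReal.ofReal (gaussDensity m σ x)).toReal • x with hI
  have h1 : I = -I := by
    rw [hI, ← integral_neg, ← integral_neg_eq_self]
    simp [gaussDensity]
  have h2 : (2 : ℝ) • I = 0 := by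
    rw [two_smul]; nth_rewrite 1 [h1]; simp
  simpa using h2

/-- variance bound for the zeroth-order batched gradient (ZoBG).
With i.i.d. Gaussian noise `w_h ∼ N(0, σ²I_m)`, deterministic initial state, measurable
dynamics, a measurable value function bounded by `B_V`, and policy Jacobians bounded in
operator norm by `B_π`, the single-sample estimator
`ĝ(w) = (1/σ²) V(w) Σ_h (D_θπ(x_h, θ))ᵀ w_h` has variance at most `B_V²B_π²Hm/σ²`, and
the `N`-sample batched estimator has variance at most `B_V²B_π²Hm/(Nσ²)`. -/
theorem zobg_variance_bound {n m d H N : ℕ} (hN : 0 < N) (σ : ℝ) (hσ : 0 < σ)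
    (φ : EuclideanSpace ℝ (Fin n) → EuclideanSpace ℝ (Fin m) → EuclideanSpace ℝ (Fin n))
    (hφ : Measurable (fun q : EuclideanSpace ℝ (Fin n) × EuclideanSpace ℝ (Fin m) =>
      φ q.1 q.2))
    (π : EuclideanSpace ℝ (Fin n) → EuclideanSpace ℝ (Fin d) → EuclideanSpace ℝ (Fin m))
    (hπ : ∀ x, Differentiable ℝ (π x))
    (x₁ : EuclideanSpace ℝ (Fin n)) (θ : EuclideanSpace ℝ (Fin d))
    (V : (Fin H → EuclideanSpace ℝ (Fin m)) → ℝ) (hV : Measurable V)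
    (BV Bπ : ℝ) (hBV : ∀ w, |V w| ≤ BV) (hBπ : ∀ x, ‖fderiv ℝ (π x) θ‖ ≤ Bπ) :
    let gauss : Measure (EuclideanSpace ℝ (Fin m)) :=
      volume.withDensity fun w => ENNReal.ofReal (gaussDensity m σ w)
    let μ : Measure (Fin H → EuclideanSpace ℝ (Fin m)) := Measure.pi fun _ : Fin H => gauss
    let ghat : (Fin H → EuclideanSpace ℝ (Fin m)) → EuclideanSpace ℝ (Fin d) := fun w =>
      (σ ^ 2)⁻¹ • V w • ∑ h : Fin H,
        (ContinuousLinearMap.adjoint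
          (fderiv ℝ (π (traj φ (fun _ => π) x₁ (extNoise w) θ (h : ℕ))) θ)) (w h)
    (∫ w, ‖ghat w - ∫ w', ghat w' ∂μ‖ ^ 2 ∂μ) ≤ BV ^ 2 * Bπ ^ 2 * H * m / σ ^ 2 ∧
    (∫ W : Fin N → (Fin H → EuclideanSpace ℝ (Fin m)),
        ‖(N : ℝ)⁻¹ • ∑ i : Fin N, ghat (W i) -
          ∫ W' : Fin N → (Fin H → EuclideanSpace ℝ (Fin m)),
            (N : ℝ)⁻¹ • ∑ i : Fin N, ghat (W' i) ∂(Measure.pi fun _ : Fin N => μ)‖ ^ 2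
        ∂(Measure.pi fun _ : Fin N => μ))
      ≤ BV ^ 2 * Bπ ^ 2 * H * m / (N * σ ^ 2) := by
  intro gauss μ ghat
  have hprob : IsProbabilityMeasure gauss := gauss_prob m σ hσ
  have hL : MemLp (fun w => w) 2 gauss :=
    memLp_of_lint gauss (fun w => w) (m * σ ^ 2) aestronglyMeasurable_id (gauss_second m σ hσ)
  have hsec : ∫ w, ‖w‖ ^ 2 ∂gauss ≤ m * σ ^ 2 :=
    integral_le_of_lint gauss _ (fun x => by positivity) _ (by positivity) (gauss_second m σ hσ)
  have hsq : Integrable (fun w => ‖w‖ ^ 2) gauss := hL.integrable_norm_pow (by norm_num)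
  have hmean : ∫ w, w ∂gauss = 0 := gauss_mean m σ
  have hBπ0 : 0 ≤ Bπ := (norm_nonneg _).trans (hBπ x₁)
  let D : ℕ → (ℕ → EuclideanSpace ℝ (Fin m)) →
      (EuclideanSpace ℝ (Fin m) →L[ℝ] EuclideanSpace ℝ (Fin d)) := fun h w =>
    ContinuousLinearMap.adjoint (fderiv ℝ (π (traj φ (fun _ => π) x₁ w θ h)) θ)
  have hD : ∀ h w v, ‖D h w v‖ ≤ Bπ * ‖v‖ := by
    intro h w v
    refine ((D h w).le_opNorm v).trans ?_
    gcongr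
    simp only [D, LinearIsometryEquiv.norm_map]
    exact hBπ _
  have htraj : ∀ (h : ℕ) (w w' : ℕ → EuclideanSpace ℝ (Fin m)), (∀ k < h, w k = w' k) →
      traj φ (fun _ => π) x₁ w θ h = traj φ (fun _ => π) x₁ w' θ h := by
    intro h w w'
    induction h with
    | zero => intro _; rfl
    | succ h ih =>
      intro hk
      simp only [traj]
      rw [ih (fun k hk' => hk k (by omega)), hk h (by omega)]
  have hcore := core gauss (Bπ ^ 2 * (m * σ ^ 2)) (fun h w v => D h w v)
    (fun h w w' hw => by simp only [D, htraj h w w' hw])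
    (fun h w => (D h w).comp_memLp' hL)
    (fun h w => by
      rw [ContinuousLinearMap.integral_comp_comm _ (hL.integrable (by norm_num)), hmean, map_zero])
    (fun h w => by
      calc ∫ v, ‖D h w v‖ ^ 2 ∂gauss ≤ ∫ v, Bπ ^ 2 * ‖v‖ ^ 2 ∂gauss := by
            refine integral_mono (((D h w).comp_memLp' hL).integrable_norm_pow (by norm_num))
              (hsq.const_mul _) (fun v => ?_)
            dsimp only
            rw [← mul_pow]
            have := hD h w v
            gcongr
        _ ≤ _ := by rw [integral_const_mul]; gcongr) H
  have hR : 0 ≤ BV ^ 2 * Bπ ^ 2 * H * m / σ ^ 2 := by positivity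
  have hlint : ∫⁻ w, ENNReal.ofReal (‖ghat w‖ ^ 2) ∂μ
      ≤ ENNReal.ofReal (BV ^ 2 * Bπ ^ 2 * H * m / σ ^ 2) := by
    have hpt : ∀ w, ENNReal.ofReal (‖ghat w‖ ^ 2) ≤ ENNReal.ofReal (BV ^ 2 / σ ^ 4) *
        ENNReal.ofReal (‖∑ h : Fin H, D h (extNoise w) (w h)‖ ^ 2) := by
      intro w
      rw [← ENNReal.ofReal_mul (by positivity)]
      apply ENNReal.ofReal_le_ofReal
      have hVw : (V w) ^ 2 ≤ BV ^ 2 := sq_le_sq' (by linarith [neg_abs_le (V w), hBV w])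
        ((le_abs_self _).trans (hBV w))
      have : ‖ghat w‖ ^ 2 = (V w) ^ 2 / σ ^ 4 * ‖∑ h : Fin H, D h (extNoise w) (w h)‖ ^ 2 := by
        change ‖(σ ^ 2)⁻¹ • V w • ∑ h : Fin H, D h (extNoise w) (w h)‖ ^ 2 = _
        rw [norm_smul, norm_smul, mul_pow, mul_pow, Real.norm_eq_abs, Real.norm_eq_abs, sq_abs,
          sq_abs]
        field_simp
      rw [this]
      gcongr
    refine (lintegral_mono hpt).trans ?_
    rw [lintegral_const_mul' _ _ ENNReal.ofReal_ne_top]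
    refine (mul_le_mul_right hcore _).trans (le_of_eq ?_)
    rw [← ENNReal.ofReal_natCast, ← ENNReal.ofReal_mul (by positivity),
      ← ENNReal.ofReal_mul (by positivity)]
    congr 1
    field_simp
  refine ⟨var_single μ ghat _ hR hlint, ?_⟩
  refine (var_batch μ ghat _ hR hlint N hN).trans (le_of_eq ?_)
  rw [div_div, mul_comm (σ ^ 2)]
end
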